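/- arXiv:2509.13452 — 2 statements merged into one kernel-verified Lean document; each statement's English description precedes it below -/
import Mathlib

section
/- For u ∈ U, there exist l ∈ L and a unitary matrix k with l = k·u if and only if every leading principal minor of the matrix (u*·u)⁻¹ equals 1. -/
open Matrix

/-- `L`: lower unitriangular `n × n` complex matrices. -/
def IsLowerUni {n : ℕ} (l : Matrix (Fin n) (Fin n) ℂ) : Prop :=
  (∀ i, l i i = 1) ∧ ∀ i j : Fin n, i < j → l i j = 0

/-- `U`: upper triangular `n × n` complex matrices with strictly positive real diagonal. -/
def IsUpperPos {n : ℕ} (u : Matrix (Fin n) (Fin n) ℂ) : Prop :=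
  (∀ i, 0 < (u i i).re ∧ (u i i).im = 0) ∧ ∀ i j : Fin n, j < i → u i j = 0

/-- A matrix is unitary if `k* · k = 1`. -/
def IsUnitaryMat {n : ℕ} (k : Matrix (Fin n) (Fin n) ℂ) : Prop :=
  kᴴ * k = 1

/-- The leading principal minor of order `m`: the determinant of the top-left
`m × m` submatrix. -/
def leadMinor {n : ℕ} (A : Matrix (Fin n) (Fin n) ℂ) (m : ℕ) (h : m ≤ n) : ℂ :=
  (A.submatrix (Fin.castLE h) (Fin.castLE h)).det


theorem leadMinor_conj {n : ℕ} (T A : Matrix (Fin n) (Fin n) ℂ) (hT : IsLowerUni T)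
    (m : ℕ) (h : m ≤ n) : leadMinor (T * A * Tᴴ) m h = leadMinor A m h := by
  obtain ⟨h1, h2⟩ := hT
  set c := Fin.castLE h with hc
  have hout : ∀ (i : Fin m) (x : Fin n), x ∉ Set.range c → T (c i) x = 0 := by
    intro i x hx
    apply h2
    by_contra hlt
    apply hx
    have : (x : ℕ) ≤ i := by simpa [hc, Fin.le_def] using hlt
    exact ⟨⟨x, by omega⟩, by ext; simp [hc]⟩
  have hinj : Function.Injective c := Fin.castLE_injective h
  have hsum : ∀ f : Fin n → ℂ, (∀ x, x ∉ Set.range c → f x = 0) →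
      ∑ x, f x = ∑ i, f (c i) := by
    intro f hf
    exact (Fintype.sum_of_injective c hinj _ f hf (fun i => rfl)).symm
  have key : (T * A * Tᴴ).submatrix c c
      = T.submatrix c c * A.submatrix c c * (T.submatrix c c)ᴴ := by
    ext i j
    simp only [submatrix_apply, mul_apply, conjTranspose_apply]
    rw [hsum _ (fun x hx => by rw [hout j x hx]; simp)]
    refine Finset.sum_congr rfl fun y _ => ?_
    rw [hsum _ (fun x hx => by rw [hout i x hx]; simp)]
  have hdet : (T.submatrix c c).det = 1 := by
    rw [det_of_isLowerTriangular]
    · simp [h1]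
    · intro i j hij
      exact h2 _ _ (by have hij' : i < j := hij
                       exact hij')
  unfold leadMinor
  rw [← hc, key, det_mul, det_mul, det_conjTranspose, hdet]
  simp

theorem exists_lower {n : ℕ} (A : Matrix (Fin n) (Fin n) ℂ) (hA : A.IsHermitian)
    (hm : ∀ (m : ℕ) (h : m ≤ n), leadMinor A m h = 1) :
    ∃ T, IsLowerUni T ∧ T * A * Tᴴ = 1 := by
  induction n with
  | zero => exact ⟨1, ⟨fun i => i.elim0, fun i => i.elim0⟩, by ext i; exact i.elim0⟩
  | succ n ih =>
    let e : Fin n ⊕ Fin 1 ≃ Fin (n + 1) := finSumFinEquiv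
    let A' := A.submatrix (Fin.castLE n.le_succ) (Fin.castLE n.le_succ)
    have hA' : A'.IsHermitian := hA.submatrix _
    obtain ⟨T', hT', hTA⟩ := ih A' hA' (fun m h => hm m (h.trans n.le_succ))
    have hdA' : A'.det = 1 := hm n n.le_succ
    have hdA : A.det = 1 := by
      have := hm (n + 1) le_rfl
      simpa [leadMinor] using this
    let b := (A.submatrix e e).toBlocks₁₂
    let c := (A.submatrix e e).toBlocks₂₂
    have hblk : A.submatrix e e = fromBlocks A' b bᴴ c := by
      rw [← fromBlocks_toBlocks (A.submatrix e e)]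
      congr 1
      ext i j
      simp only [b, toBlocks₂₁, toBlocks₁₂, conjTranspose_apply, of_apply, submatrix_apply]
      exact (hA.apply _ _).symm
    let r := -(A'⁻¹ * b)
    have hr : A' * r = -b := by
      simp only [r, Matrix.mul_neg]
      rw [mul_nonsing_inv_cancel_left _ _ (by simp [hdA'])]
    have hr' : rᴴ * A' = -bᴴ := by
      have := congrArg conjTranspose hr
      rwa [conjTranspose_mul, hA'.eq, conjTranspose_neg] at this
    let S := fromBlocks T' 0 rᴴ (1 : Matrix (Fin 1) (Fin 1) ℂ)
    have hdT' : T'.det = 1 := by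
      rw [det_of_isLowerTriangular]
      · simp [hT'.1]
      · intro i j hij
        exact hT'.2 _ _ (by simpa using hij)
    have hdS : S.det = 1 := by
      simp [S, det_fromBlocks_zero₁₂, hdT']
    have hprod : S * A.submatrix e e * Sᴴ = fromBlocks 1 0 0 (rᴴ * b + c) := by
      rw [hblk]
      simp only [S, fromBlocks_conjTranspose, fromBlocks_multiply, hr']
      simp [hTA, Matrix.mul_assoc, hr]
    have hs : rᴴ * b + c = 1 := by
      have := congrArg det hprod
      rw [det_mul, det_mul, det_conjTranspose, hdS, det_submatrix_equiv_self, hdA,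
        det_fromBlocks_zero₂₁] at this
      ext i j
      fin_cases i; fin_cases j
      simpa using this.symm
    rw [hs, fromBlocks_one] at hprod
    refine ⟨S.submatrix e.symm e.symm, ⟨?_, ?_⟩, ?_⟩
    · intro i
      obtain ⟨x, rfl⟩ := e.surjective i
      rcases x with x | x
      · simp [S, hT'.1]
      · simp [S]
    · intro i j hij
      obtain ⟨x, rfl⟩ := e.surjective i
      obtain ⟨y, rfl⟩ := e.surjective j
      rcases x with x | x <;> rcases y with y | y
      · have hxy : x.val < y.val := hij
        simpa [S] using hT'.2 x y hxy
      · simp [S]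
      · exfalso
        have := y.2
        simp [e, Fin.lt_def] at hij
        omega
      · exfalso
        simp [e, Fin.lt_def] at hij
    · have hAe : A = (A.submatrix e e).submatrix e.symm e.symm := by simp
      rw [hAe, conjTranspose_submatrix, submatrix_mul_equiv, submatrix_mul_equiv, hprod]
      simp

/-- For `u ∈ U`, there exist `l ∈ L` and a unitary `k` with `l = k·u` iff every
leading principal minor of `(u*·u)⁻¹` equals `1`. -/
theorem stmt3 (n : ℕ) (hn : 0 < n) (u : Matrix (Fin n) (Fin n) ℂ)
    (hu : IsUpperPos u) :
    (∃ l k : Matrix (Fin n) (Fin n) ℂ, IsLowerUni l ∧ IsUnitaryMat k ∧ l = k * u) ↔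
      ∀ (m : ℕ) (h : m ≤ n), leadMinor (uᴴ * u)⁻¹ m h = 1 := by
  have hdu : IsUnit u.det := by
    rw [det_of_isUpperTriangular (fun i j hij => hu.2 i j (by simpa using hij))]
    rw [isUnit_iff_ne_zero, Finset.prod_ne_zero_iff]
    intro i _ h0
    have := (hu.1 i).1
    rw [h0] at this
    simp at this
  have hduc : IsUnit (uᴴ).det := by rw [det_conjTranspose]; exact hdu.star
  have hP : (uᴴ * u)⁻¹ = u⁻¹ * (u⁻¹)ᴴ := by
    rw [Matrix.mul_inv_rev, conjTranspose_nonsing_inv]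
  constructor
  · rintro ⟨l, k, hl, hk, rfl⟩ m h
    rw [← leadMinor_conj _ _ hl, hP]
    have hk' : k * kᴴ = 1 := mul_eq_one_comm.mp hk
    have : k * u * (u⁻¹ * u⁻¹ᴴ) * (k * u)ᴴ = 1 := by
      calc _ = k * (u * u⁻¹) * (u * u⁻¹)ᴴ * kᴴ := by
            simp only [conjTranspose_mul, Matrix.mul_assoc]
        _ = 1 := by rw [mul_nonsing_inv _ hdu]; simpa using hk'
    rw [this, leadMinor, submatrix_one _ (Fin.castLE_injective h), det_one]
  · intro hm
    obtain ⟨T, hT, hTP⟩ := exists_lower _ ((isHermitian_conjTranspose_mul_self u).inv) hm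
    refine ⟨T, T * u⁻¹, hT, ?_, ?_⟩
    · apply mul_eq_one_comm.mp
      rw [← hTP, hP, conjTranspose_mul]
      simp only [Matrix.mul_assoc]
    · rw [Matrix.mul_assoc, nonsing_inv_mul _ hdu, Matrix.mul_one]
end

section
/- Let Λ be a diagonal n×n complex matrix with pairwise distinct diagonal entries and let O = {g·Λ·g⁻¹ : g ∈ GL_n(ℂ)} be its conjugacy class. Then the chart domain V = {(l·k)⁻¹·Λ·(l·k) : k ∈ C, l ∈ L} satisfies: V ⊆ O; V is open in O in the subspace topology inherited from the space of n×n complex matrices (i.e., V = O ∩ W for some open subset W of the matrix space); and V is dense in O (i.e., O is contained in the closure of V). -/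
open Matrix

/-- `C`: unitary matrices admitting an `LU` factorization with `l ∈ L`, `u ∈ U`. -/
def InBigCell {n : ℕ} (k : Matrix (Fin n) (Fin n) ℂ) : Prop :=
  IsUnitaryMat k ∧ ∃ l u : Matrix (Fin n) (Fin n) ℂ, IsLowerUni l ∧ IsUpperPos u ∧ k = l * u


/-- All leading principal minors are nonzero. -/
def Good {n : ℕ} (A : Matrix (Fin n) (Fin n) ℂ) : Prop :=
  ∀ (m : ℕ) (h : m ≤ n), leadMinor A m h ≠ 0

theorem Good.det_ne {n : ℕ} {A : Matrix (Fin n) (Fin n) ℂ} (h : Good A) : A.det ≠ 0 := by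
  have := h n le_rfl
  unfold leadMinor at this
  simpa using this

theorem IsLowerUni.det_eq {n : ℕ} {l : Matrix (Fin n) (Fin n) ℂ} (h : IsLowerUni l) :
    l.det = 1 := by
  rw [Matrix.det_of_isLowerTriangular]
  · simp [h.1]
  · intro i j hij
    exact h.2 i j hij

theorem IsLowerUni.mul {n : ℕ} {l m : Matrix (Fin n) (Fin n) ℂ} (hl : IsLowerUni l)
    (hm : IsLowerUni m) : IsLowerUni (l * m) := by
  constructor
  · intro i
    rw [Matrix.mul_apply, Finset.sum_eq_single i]
    · rw [hl.1, hm.1, one_mul]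
    · intro j _ hj
      rcases lt_or_gt_of_ne hj with h | h
      · rw [hm.2 j i h, mul_zero]
      · rw [hl.2 i j h, zero_mul]
    · simp
  · intro i j hij
    rw [Matrix.mul_apply]
    apply Finset.sum_eq_zero
    intro a _
    rcases lt_or_ge i a with h | h
    · rw [hl.2 i a h, zero_mul]
    · rw [hm.2 a j (lt_of_le_of_lt h hij), mul_zero]

theorem IsLowerUni.inv {n : ℕ} {l : Matrix (Fin n) (Fin n) ℂ} (hl : IsLowerUni l) :
    IsLowerUni l⁻¹ := by
  have hu : IsUnit l.det := by rw [hl.det_eq]; exact isUnit_one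
  have hlt : ∀ i j : Fin n, i < j → l⁻¹ i j = 0 := by
    have : Invertible l := l.invertibleOfIsUnitDet hu
    have hb : l.BlockTriangular (OrderDual.toDual) := fun i j hij => hl.2 i j hij
    have := Matrix.blockTriangular_inv_of_blockTriangular hb
    exact fun i j hij => this hij
  refine ⟨fun i => ?_, hlt⟩
  have h1 : (l * l⁻¹) i i = 1 := by rw [Matrix.mul_nonsing_inv l hu]; simp
  rw [Matrix.mul_apply, Finset.sum_eq_single i] at h1
  · rwa [hl.1, one_mul] at h1
  · intro j _ hj
    rcases lt_or_gt_of_ne hj with h | h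
    · rw [hlt j i h, mul_zero]
    · rw [hl.2 i j h, zero_mul]
  · simp

theorem IsLowerUni.conj {n : ℕ} {l : Matrix (Fin n) (Fin n) ℂ} (hl : IsLowerUni l)
    (t : Fin n → ℂ) (ht : ∀ i, t i ≠ 0) :
    IsLowerUni (diagonal t * l * diagonal (fun i => (t i)⁻¹)) := by
  constructor
  · intro i
    simp [hl.1, ht i]
  · intro i j hij
    simp [hl.2 i j hij]

theorem good_of_lu {n : ℕ} {l u : Matrix (Fin n) (Fin n) ℂ} (hl : IsLowerUni l)
    (hu : ∀ i j : Fin n, j < i → u i j = 0) (hd : ∀ i, u i i ≠ 0) : Good (l * u) := by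
  intro m h
  have key : (l * u).submatrix (Fin.castLE h) (Fin.castLE h) =
      l.submatrix (Fin.castLE h) (Fin.castLE h) * u.submatrix (Fin.castLE h) (Fin.castLE h) := by
    ext i j
    simp only [Matrix.submatrix_apply, Matrix.mul_apply]
    symm
    refine (Finset.sum_map Finset.univ (Fin.castLEEmb h)
      (fun a => l (Fin.castLE h i) a * u a (Fin.castLE h j))).symm.trans ?_
    apply Finset.sum_subset (Finset.subset_univ _)
    intro a _ ha
    have : Fin.castLE h i < a := by
      by_contra hc
      apply ha
      rw [Finset.mem_map]
      have h2 : (a : ℕ) ≤ i := by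
        simpa [Fin.le_def] using not_lt.mp hc
      exact ⟨⟨a, lt_of_le_of_lt h2 i.2⟩, Finset.mem_univ _, by ext; simp⟩
    rw [hl.2 _ _ this, zero_mul]
  unfold leadMinor
  rw [key, Matrix.det_mul, Matrix.det_of_isLowerTriangular, Matrix.det_of_isUpperTriangular]
  · simp [hl.1, Finset.prod_ne_zero_iff, hd]
  · intro i j hij
    exact hu (Fin.castLE h i) (Fin.castLE h j) hij
  · intro i j hij
    exact hl.2 (Fin.castLE h i) (Fin.castLE h j) hij

theorem leadMinor_diag {n : ℕ} (t : Fin n → ℂ) (A : Matrix (Fin n) (Fin n) ℂ) (m : ℕ)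
    (h : m ≤ n) : leadMinor (diagonal t * A) m h =
      (∏ i : Fin m, t (Fin.castLE h i)) * leadMinor A m h := by
  unfold leadMinor
  rw [← Matrix.det_diagonal, ← Matrix.det_mul]
  congr 1
  ext i j
  simp

theorem good_of_diag {n : ℕ} {t : Fin n → ℂ} {A : Matrix (Fin n) (Fin n) ℂ}
    (h : Good (diagonal t * A)) : Good A := by
  intro m hm h0
  apply h m hm
  rw [leadMinor_diag, h0, mul_zero]

theorem exists_lower_s9 {n : ℕ} {g : Matrix (Fin n) (Fin n) ℂ} (hg : Good g) :
    ∃ m : Matrix (Fin n) (Fin n) ℂ, IsLowerUni m ∧ ∀ i j : Fin n, j < i → (m * g) i j = 0 := by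
  have row : ∀ i : Fin n, ∃ r : Fin n → ℂ, r i = 1 ∧ (∀ j, i < j → r j = 0) ∧
      ∀ j, j < i → ∑ a, r a * g a j = 0 := by
    intro i
    have hi : (i : ℕ) ≤ n := i.2.le
    set A := g.submatrix (Fin.castLE hi) (Fin.castLE hi) with hA
    have hdet : IsUnit A.det := (hg i hi).isUnit
    set c : Fin (i : ℕ) → ℂ := (fun j => - g i (Fin.castLE hi j)) ᵥ* A⁻¹ with hc
    have hcA : c ᵥ* A = fun j => - g i (Fin.castLE hi j) := by
      rw [hc, Matrix.vecMul_vecMul, Matrix.nonsing_inv_mul A hdet, Matrix.vecMul_one]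
    refine ⟨fun a => if h : a < i then c ⟨a, h⟩ else if a = i then 1 else 0, by simp,
      fun j hj => by simp [not_lt.mpr hj.le, hj.ne'], fun j hj => ?_⟩
    have h1 := congrFun hcA ⟨j, hj⟩
    have h2 : ∀ a : Fin n, (if h : a < i then c ⟨a, h⟩ else if a = i then 1 else 0) * g a j =
        (if h : a < i then c ⟨a, h⟩ * g a j else 0) + (if a = i then g a j else 0) := by
      intro a
      by_cases h : a < i
      · simp [h, h.ne]
      · simp [h]
    have h3 : ∑ a : Fin n, (if h : a < i then c ⟨a, h⟩ * g a j else 0) =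
        ∑ b : Fin (i : ℕ), c b * g (Fin.castLE hi b) j := by
      have : ∀ b : Fin (i : ℕ), c b * g (Fin.castLE hi b) j =
          (fun a : Fin n => if h : a < i then c ⟨a, h⟩ * g a j else 0) (Fin.castLEEmb hi b) := by
        intro b
        have : Fin.castLE hi b < i := by simp [Fin.lt_def]
        simp [this]
      rw [Finset.sum_congr rfl (fun b _ => this b)]
      symm
      refine (Finset.sum_map Finset.univ (Fin.castLEEmb hi)
        (fun a : Fin n => if h : a < i then c ⟨a, h⟩ * g a j else 0)).symm.trans ?_
      apply Finset.sum_subset (Finset.subset_univ _)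
      intro a _ ha
      have : ¬ a < i := by
        intro hlt
        apply ha
        rw [Finset.mem_map]
        exact ⟨⟨a, hlt⟩, Finset.mem_univ _, by ext; simp⟩
      simp [this]
    rw [Finset.sum_congr rfl (fun a _ => h2 a), Finset.sum_add_distrib, h3]
    simp only [Matrix.vecMul, dotProduct, hA, Matrix.submatrix_apply] at h1
    have h4 : Fin.castLE hi ⟨j, hj⟩ = j := by ext; simp
    rw [h4] at h1
    rw [h1]
    simp
  choose r h1 h2 h3 using row
  exact ⟨Matrix.of r, ⟨h1, h2⟩, fun i j hij => by simpa [Matrix.mul_apply] using h3 i j hij⟩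

theorem upper_diag_ne {n : ℕ} {u : Matrix (Fin n) (Fin n) ℂ}
    (hu : ∀ i j : Fin n, j < i → u i j = 0) (hd : u.det ≠ 0) (i : Fin n) : u i i ≠ 0 := by
  rw [Matrix.det_of_isUpperTriangular (fun i j h => hu i j h)] at hd
  exact Finset.prod_ne_zero_iff.mp hd i (Finset.mem_univ _)

section
open scoped ComplexOrder

theorem good_posDef {n : ℕ} {S : Matrix (Fin n) (Fin n) ℂ} (hS : S.PosDef) : Good S := by
  intro m h
  have := hS.submatrix (e := Fin.castLE h) (Fin.castLE_injective h)
  exact this.det_pos.ne'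

/-- For an upper triangular matrix with positive diagonal, a positive row rescaling can be
completed by a lower unitriangular factor to a unitary matrix. -/
theorem exists_unitary {n : ℕ} {u : Matrix (Fin n) (Fin n) ℂ} (hu : u.det ≠ 0) :
    ∃ (m : Matrix (Fin n) (Fin n) ℂ) (a : Fin n → ℝ), IsLowerUni m ∧ (∀ i, 0 < a i) ∧
      IsUnitaryMat (diagonal (fun i => (a i : ℂ)) * m * u) := by
  have hun : IsUnit u := (Matrix.isUnit_iff_isUnit_det u).mpr hu.isUnit
  have hS : (u * uᴴ).PosDef := by
    have := (Matrix.PosDef.one (n := Fin n) (R := ℂ)).mul_mul_conjTranspose_same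
      (B := u) (Matrix.vecMul_injective_iff_isUnit.mpr hun)
    simpa using this
  obtain ⟨m, hm, hmS⟩ := exists_lower_s9 (good_posDef hS)
  have hmu : IsUnit m := (Matrix.isUnit_iff_isUnit_det m).mpr (by rw [hm.det_eq]; exact isUnit_one)
  set D := m * (u * uᴴ) * mᴴ with hD
  have hDp : D.PosDef := hS.mul_mul_conjTranspose_same (Matrix.vecMul_injective_iff_isUnit.mpr hmu)
  have hlow : ∀ i j : Fin n, j < i → D i j = 0 := by
    intro i j hij
    rw [hD, Matrix.mul_apply]
    apply Finset.sum_eq_zero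
    intro b _
    rcases lt_or_ge b i with h | h
    · rw [hmS i b h, zero_mul]
    · rw [Matrix.conjTranspose_apply, hm.2 j b (lt_of_lt_of_le hij h), star_zero, mul_zero]
  have hoff : ∀ i j : Fin n, i ≠ j → D i j = 0 := by
    intro i j hij
    rcases lt_or_gt_of_ne hij with h | h
    · rw [← hDp.isHermitian.apply i j, hlow j i h, star_zero]
    · exact hlow i j h
  have hpos : ∀ i, 0 < D i i := fun i => hDp.diag_pos
  have hre : ∀ i, 0 < (D i i).re := fun i => (Complex.lt_def.mp (hpos i)).1
  have hDi : ∀ i, D i i = ((D i i).re : ℂ) := fun i => by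
    apply Complex.ext
    · simp
    · simpa using (Complex.lt_def.mp (hpos i)).2.symm
  refine ⟨m, fun i => (Real.sqrt (D i i).re)⁻¹, hm, fun i => inv_pos.mpr (Real.sqrt_pos.mpr (hre i)),
    ?_⟩
  unfold IsUnitaryMat
  rw [mul_eq_one_comm]
  set a : Fin n → ℂ := fun i => (((Real.sqrt (D i i).re)⁻¹ : ℝ) : ℂ) with ha
  have e1 : (diagonal a * m * u) * (diagonal a * m * u)ᴴ = diagonal a * D * (diagonal a)ᴴ := by
    simp only [hD, Matrix.conjTranspose_mul, Matrix.mul_assoc]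
  rw [e1, Matrix.diagonal_conjTranspose]
  ext i j
  rw [Matrix.mul_diagonal, Matrix.diagonal_mul]
  by_cases hij : i = j
  · subst hij
    rw [Matrix.one_apply_eq, hDi i]
    simp only [ha, Pi.star_apply]
    rw [show star ((((Real.sqrt (D i i).re)⁻¹ : ℝ) : ℂ)) = (((Real.sqrt (D i i).re)⁻¹ : ℝ) : ℂ) from
      Complex.conj_ofReal _]
    norm_cast
    have h5 := Real.mul_self_sqrt (hre i).le
    have h6 := (Real.sqrt_pos.mpr (hre i)).ne'
    field_simp
    rw [sq, h5]
  · rw [hoff i j hij, Matrix.one_apply_ne hij]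
    simp

end

theorem good_factor {n : ℕ} {g : Matrix (Fin n) (Fin n) ℂ} (hg : Good g) :
    ∃ (t : Fin n → ℂ) (k l : Matrix (Fin n) (Fin n) ℂ), (∀ i, t i ≠ 0) ∧ InBigCell k ∧
      IsLowerUni l ∧ diagonal t * g = l * k := by
  obtain ⟨m, hm, hmg⟩ := exists_lower_s9 hg
  have hud : ∀ i, (m * g) i i ≠ 0 := upper_diag_ne hmg (by
    rw [Matrix.det_mul, hm.det_eq, one_mul]; exact hg.det_ne)
  set c : Fin n → ℂ := fun i => ((m * g) i i)⁻¹ with hc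
  have hc0 : ∀ i, c i ≠ 0 := fun i => inv_ne_zero (hud i)
  set u := diagonal c * (m * g) with hu
  have huu : ∀ i j : Fin n, j < i → u i j = 0 := fun i j h => by
    rw [hu, Matrix.diagonal_mul, hmg i j h, mul_zero]
  have hu1 : ∀ i, u i i = 1 := fun i => by
    rw [hu, Matrix.diagonal_mul, hc]; exact inv_mul_cancel₀ (hud i)
  have hudet : u.det ≠ 0 := by
    rw [Matrix.det_of_isUpperTriangular (fun i j h => huu i j h)]
    simp [hu1]
  obtain ⟨m', a, hm', ha, hk⟩ := exists_unitary hudet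
  set A : Fin n → ℂ := fun i => (a i : ℂ) with hA
  have hA0 : ∀ i, A i ≠ 0 := fun i => by simpa [hA] using (ha i).ne'
  set t : Fin n → ℂ := fun i => A i * c i with ht
  have ht0 : ∀ i, t i ≠ 0 := fun i => mul_ne_zero (hA0 i) (hc0 i)
  have hAi : diagonal (fun i => (A i)⁻¹) * diagonal A = 1 := by
    rw [Matrix.diagonal_mul_diagonal, ← Matrix.diagonal_one]
    congr 1; ext i; exact inv_mul_cancel₀ (hA0 i)
  have hti : diagonal (fun i => (t i)⁻¹) * diagonal t = 1 := by
    rw [Matrix.diagonal_mul_diagonal, ← Matrix.diagonal_one]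
    congr 1; ext i; exact inv_mul_cancel₀ (ht0 i)
  have hAc : diagonal A * diagonal c = diagonal t := Matrix.diagonal_mul_diagonal _ _
  have h1 := hm'.conj A hA0
  have h2 := hm.conj t ht0
  have h3 := h1.mul h2
  have e1 : diagonal A * m' * u =
      (diagonal A * m' * diagonal (fun i => (A i)⁻¹)) * (diagonal A * u) := by
    rw [Matrix.mul_assoc (diagonal A * m'), ← Matrix.mul_assoc _ (diagonal A) u, hAi, Matrix.one_mul]
  have e2 : diagonal A * u = (diagonal t * m * diagonal (fun i => (t i)⁻¹)) * (diagonal t * g) := by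
    rw [Matrix.mul_assoc (diagonal t * m), ← Matrix.mul_assoc _ (diagonal t) g, hti, Matrix.one_mul,
      hu, ← hAc]
    simp only [Matrix.mul_assoc]
  refine ⟨t, diagonal A * m' * u, _, ht0, ⟨hk, _, diagonal A * u, h1, ⟨?_, ?_⟩, e1⟩, h3.inv, ?_⟩
  · intro i
    rw [Matrix.diagonal_mul, hu1, mul_one]
    simp [hA, ha i]
  · intro i j hij
    rw [Matrix.diagonal_mul, huu i j hij, mul_zero]
  · rw [e1, e2, ← Matrix.mul_assoc _ _ (diagonal t * g), ← Matrix.mul_assoc,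
      Matrix.nonsing_inv_mul _ (by rw [h3.det_eq]; exact isUnit_one), Matrix.one_mul]

theorem good_of_cell {n : ℕ} {k l : Matrix (Fin n) (Fin n) ℂ} (hk : InBigCell k)
    (hl : IsLowerUni l) : Good (l * k) := by
  obtain ⟨_, l', u, hl', hu, rfl⟩ := hk
  rw [← Matrix.mul_assoc]
  refine good_of_lu (hl.mul hl') hu.2 (fun i h => ?_)
  have := (hu.1 i).1
  rw [h] at this
  simp at this

/-- The chart domain is the set of `g⁻¹ Λ g` with `g` having nonzero leading minors. -/
theorem mem_V_iff {n : ℕ} (d : Fin n → ℂ) (X : Matrix (Fin n) (Fin n) ℂ) :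
    (∃ k l : Matrix (Fin n) (Fin n) ℂ,
        InBigCell k ∧ IsLowerUni l ∧ X = (l * k)⁻¹ * Matrix.diagonal d * (l * k)) ↔
    ∃ g, Good g ∧ X = g⁻¹ * Matrix.diagonal d * g := by
  constructor
  · rintro ⟨k, l, hk, hl, rfl⟩
    exact ⟨l * k, good_of_cell hk hl, rfl⟩
  · rintro ⟨g, hg, rfl⟩
    obtain ⟨t, k, l, ht, hk, hl, e⟩ := good_factor hg
    refine ⟨k, l, hk, hl, ?_⟩
    have htd : IsUnit (diagonal t).det := by
      rw [Matrix.det_diagonal]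
      exact (Finset.prod_ne_zero_iff.mpr fun i _ => ht i).isUnit
    have hcomm : diagonal d * diagonal t = diagonal t * diagonal d := by
      rw [Matrix.diagonal_mul_diagonal, Matrix.diagonal_mul_diagonal]
      congr 1; ext i; exact mul_comm _ _
    rw [← e, Matrix.mul_inv_rev, Matrix.mul_assoc (g⁻¹ * _), ← Matrix.mul_assoc (diagonal d), hcomm,
      Matrix.mul_assoc g⁻¹, Matrix.mul_assoc (diagonal t), Matrix.mul_assoc g⁻¹, ← Matrix.mul_assoc _ (diagonal t),
      Matrix.nonsing_inv_mul _ htd, Matrix.one_mul]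

theorem aeval_conj {n : ℕ} (d : Fin n → ℂ) {g : Matrix (Fin n) (Fin n) ℂ} (hg : IsUnit g.det)
    (p : Polynomial ℂ) : Polynomial.aeval (g⁻¹ * diagonal d * g) p =
      g⁻¹ * diagonal (fun i => p.eval (d i)) * g := by
  induction p using Polynomial.induction_on' with
  | add p q hp hq =>
    rw [map_add, hp, hq, ← Matrix.add_mul, ← Matrix.mul_add, Matrix.diagonal_add]
    simp
  | monomial k c =>
    have hpow : (g⁻¹ * diagonal d * g) ^ k = g⁻¹ * diagonal (fun i => d i ^ k) * g := by
      induction k with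
      | zero => simp [Matrix.nonsing_inv_mul _ hg]
      | succ k ih =>
        rw [pow_succ, ih, Matrix.mul_assoc (g⁻¹ * _) g, ← Matrix.mul_assoc g (g⁻¹ * diagonal d) g,
          ← Matrix.mul_assoc g, Matrix.mul_nonsing_inv _ hg, Matrix.one_mul, ← Matrix.mul_assoc,
          Matrix.mul_assoc g⁻¹, Matrix.diagonal_mul_diagonal]
        simp [pow_succ]
    rw [Polynomial.aeval_monomial, hpow, ← Algebra.smul_def, ← Matrix.smul_mul, ← Matrix.mul_smul,
      ← Matrix.diagonal_smul]
    simp only [Polynomial.eval_monomial]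
    rfl

/-- Row-scaled version of the diagonalizing matrix, as a continuous function of `X`. -/
noncomputable def rowMat {n : ℕ} (d : Fin n → ℂ) (w X : Matrix (Fin n) (Fin n) ℂ) :
    Matrix (Fin n) (Fin n) ℂ :=
  Matrix.of fun i j => ∑ a, w i a * (Polynomial.aeval X (Lagrange.basis Finset.univ d i)) a j

theorem rowMat_eq {n : ℕ} (d : Fin n → ℂ) (hd : Function.Injective d)
    (w : Matrix (Fin n) (Fin n) ℂ) {g : Matrix (Fin n) (Fin n) ℂ} (hg : IsUnit g.det) :
    rowMat d w (g⁻¹ * diagonal d * g) = diagonal (fun i => (w * g⁻¹) i i) * g := by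
  ext i j
  have hb : (fun b => (Lagrange.basis Finset.univ d i).eval (d b)) = Pi.single i 1 := by
    ext b
    by_cases h : i = b
    · subst h
      rw [Lagrange.eval_basis_self hd.injOn (Finset.mem_univ _)]
      simp
    · rw [Lagrange.eval_basis_of_ne h (Finset.mem_univ _)]
      simp [Ne.symm h]
  rw [rowMat, Matrix.of_apply, aeval_conj d hg, hb, Matrix.diagonal_mul, Matrix.mul_apply,
    Finset.sum_mul]
  apply Finset.sum_congr rfl
  intro a _
  rw [mul_assoc (w i a)]
  refine congrArg (w i a * ·) ?_
  rw [Matrix.mul_apply, Finset.sum_eq_single i]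
  · simp
  · intro b _ hb
    simp [hb]
  · simp

theorem rowMat_continuous {n : ℕ} (d : Fin n → ℂ) (w : Matrix (Fin n) (Fin n) ℂ) :
    Continuous (rowMat d w) := by
  unfold rowMat
  refine continuous_matrix fun i j => ?_
  simp only [Matrix.of_apply]
  refine continuous_finsetSum _ fun a _ => continuous_const.mul ?_
  exact (Polynomial.continuous_aeval _).matrix_elem a j

theorem isOpen_good {n : ℕ} : IsOpen {A : Matrix (Fin n) (Fin n) ℂ | Good A} := by
  have : {A : Matrix (Fin n) (Fin n) ℂ | Good A} =
      ⋂ m : Fin (n + 1), {A | leadMinor A m (Nat.lt_succ_iff.mp m.2) ≠ 0} := by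
    ext A
    simp only [Set.mem_ofPred_eq, Set.mem_iInter]
    exact ⟨fun h m => h m _, fun h m hm => h ⟨m, Nat.lt_succ_iff.mpr hm⟩⟩
  rw [this]
  refine isOpen_iInter_of_finite fun m => ?_
  refine isOpen_ne_fun ?_ continuous_const
  unfold leadMinor
  exact (continuous_id.matrix_submatrix _ _).matrix_det

theorem finite_bad {n : ℕ} (g : Matrix (Fin n) (Fin n) ℂ) :
    {s : ℂ | ¬ Good (g + Matrix.scalar (Fin n) s)}.Finite := by
  have : {s : ℂ | ¬ Good (g + Matrix.scalar (Fin n) s)} ⊆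
      ⋃ m : Fin (n + 1), {s | ((-(g.submatrix (Fin.castLE (Nat.lt_succ_iff.mp m.2))
        (Fin.castLE (Nat.lt_succ_iff.mp m.2)))).charpoly).IsRoot s} := by
    intro s hs
    simp only [Set.mem_ofPred_eq, Good, not_forall, not_not] at hs
    obtain ⟨m, hm, h⟩ := hs
    rw [Set.mem_iUnion]
    refine ⟨⟨m, Nat.lt_succ_iff.mpr hm⟩, ?_⟩
    simp only [Set.mem_ofPred_eq, Polynomial.IsRoot.def]
    rw [Matrix.eval_charpoly, ← h, leadMinor]
    congr 1
    ext i j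
    simp [Matrix.diagonal_apply]
    exact add_comm _ _
  refine (Set.finite_iUnion fun m => ?_).subset this
  exact Polynomial.finite_setOfPred_isRoot (Matrix.charpoly_monic _).ne_zero

/-- The chart domain `V = {(l·k)⁻¹·Λ·(l·k) : k ∈ C, l ∈ L}` is contained in the
conjugacy class `O` of `Λ`, is open in `O` in the subspace topology, and is dense
in `O`. -/
theorem stmt9 (n : ℕ) (hn : 0 < n) (d : Fin n → ℂ) (hd : Function.Injective d) :
    {X : Matrix (Fin n) (Fin n) ℂ | ∃ k l : Matrix (Fin n) (Fin n) ℂ,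
        InBigCell k ∧ IsLowerUni l ∧ X = (l * k)⁻¹ * Matrix.diagonal d * (l * k)} ⊆
      {X : Matrix (Fin n) (Fin n) ℂ | ∃ g : Matrix (Fin n) (Fin n) ℂ,
        IsUnit g ∧ X = g * Matrix.diagonal d * g⁻¹} ∧
    (∃ W : Set (Matrix (Fin n) (Fin n) ℂ), IsOpen W ∧
      {X : Matrix (Fin n) (Fin n) ℂ | ∃ k l : Matrix (Fin n) (Fin n) ℂ,
          InBigCell k ∧ IsLowerUni l ∧ X = (l * k)⁻¹ * Matrix.diagonal d * (l * k)} =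
        {X : Matrix (Fin n) (Fin n) ℂ | ∃ g : Matrix (Fin n) (Fin n) ℂ,
          IsUnit g ∧ X = g * Matrix.diagonal d * g⁻¹} ∩ W) ∧
    {X : Matrix (Fin n) (Fin n) ℂ | ∃ g : Matrix (Fin n) (Fin n) ℂ,
        IsUnit g ∧ X = g * Matrix.diagonal d * g⁻¹} ⊆
      closure {X : Matrix (Fin n) (Fin n) ℂ | ∃ k l : Matrix (Fin n) (Fin n) ℂ,
        InBigCell k ∧ IsLowerUni l ∧ X = (l * k)⁻¹ * Matrix.diagonal d * (l * k)} := by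
  have hV : {X : Matrix (Fin n) (Fin n) ℂ | ∃ k l : Matrix (Fin n) (Fin n) ℂ,
        InBigCell k ∧ IsLowerUni l ∧ X = (l * k)⁻¹ * Matrix.diagonal d * (l * k)} =
      {X | ∃ g, Good g ∧ X = g⁻¹ * Matrix.diagonal d * g} := by
    ext X
    exact mem_V_iff d X
  have hO : {X : Matrix (Fin n) (Fin n) ℂ | ∃ g : Matrix (Fin n) (Fin n) ℂ,
        IsUnit g ∧ X = g * Matrix.diagonal d * g⁻¹} =
      {X | ∃ g : Matrix (Fin n) (Fin n) ℂ, IsUnit g.det ∧ X = g⁻¹ * Matrix.diagonal d * g} := by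
    ext X
    constructor
    · rintro ⟨g, hg, rfl⟩
      have hg' := (Matrix.isUnit_iff_isUnit_det g).mp hg
      exact ⟨g⁻¹, Matrix.isUnit_nonsing_inv_det g hg', by rw [Matrix.nonsing_inv_nonsing_inv g hg']⟩
    · rintro ⟨g, hg', rfl⟩
      exact ⟨g⁻¹, (Matrix.isUnit_iff_isUnit_det _).mpr (Matrix.isUnit_nonsing_inv_det g hg'),
        by rw [Matrix.nonsing_inv_nonsing_inv g hg']⟩
  rw [hV, hO]
  have hsub : {X | ∃ g, Good g ∧ X = g⁻¹ * Matrix.diagonal d * g} ⊆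
      {X | ∃ g : Matrix (Fin n) (Fin n) ℂ, IsUnit g.det ∧ X = g⁻¹ * Matrix.diagonal d * g} := by
    rintro X ⟨g, hg, rfl⟩
    exact ⟨g, hg.det_ne.isUnit, rfl⟩
  refine ⟨hsub, ⟨⋃ w, rowMat d w ⁻¹' {A | Good A},
    isOpen_iUnion fun w => isOpen_good.preimage (rowMat_continuous d w), ?_⟩, ?_⟩
  · ext X
    constructor
    · intro hX
      refine ⟨hsub hX, ?_⟩
      obtain ⟨g, hg, rfl⟩ := hX
      rw [Set.mem_iUnion]
      refine ⟨g, ?_⟩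
      have hu := hg.det_ne.isUnit
      rw [Set.mem_preimage, rowMat_eq d hd _ hu, Matrix.mul_nonsing_inv _ hu]
      simpa using hg
    · rintro ⟨⟨g, hg, rfl⟩, hW⟩
      obtain ⟨w, hw⟩ := Set.mem_iUnion.mp hW
      rw [Set.mem_preimage, rowMat_eq d hd _ hg] at hw
      exact ⟨g, good_of_diag hw, rfl⟩
  · rintro X ⟨g, hg, rfl⟩
    set F : ℂ → Matrix (Fin n) (Fin n) ℂ := fun s => g + Matrix.scalar (Fin n) s with hF
    have hFc : Continuous F := by
      refine continuous_const.add ?_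
      exact (continuous_pi fun _ => continuous_id).matrix_diagonal
    have hF0 : F 0 = g := by simp [hF]
    have hinv : ContinuousAt (fun s => (F s)⁻¹) 0 := by
      simp only [Matrix.inv_def, Ring.inverse_eq_inv']
      have h7 : ContinuousAt (fun s => ((F s).det)⁻¹) 0 := by
        refine ContinuousAt.inv₀ hFc.matrix_det.continuousAt ?_
        rw [hF0]; exact hg.ne_zero
      exact h7.smul hFc.matrix_adjugate.continuousAt
    have hcont : ContinuousAt (fun s => (F s)⁻¹ * diagonal d * F s) 0 :=
      (hinv.mul continuousAt_const).mul hFc.continuousAt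
    have ht : Filter.Tendsto (fun s => (F s)⁻¹ * diagonal d * F s) (nhdsWithin 0 {0}ᶜ)
        (nhds (g⁻¹ * diagonal d * g)) := by
      have := hcont.tendsto
      simp only [hF0] at this
      exact this.mono_left nhdsWithin_le_nhds
    refine mem_closure_of_tendsto ht ?_
    have hfin := finite_bad g
    have h1 : ({s : ℂ | ¬ Good (g + Matrix.scalar (Fin n) s)} \ {0})ᶜ ∈ nhds (0 : ℂ) :=
      (hfin.subset Set.sdiff_subset).isClosed.isOpen_compl.mem_nhds (by simp)
    filter_upwards [mem_nhdsWithin_of_mem_nhds h1, self_mem_nhdsWithin] with s hs hs0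
    refine ⟨F s, ?_, rfl⟩
    by_contra hc
    exact hs ⟨hc, hs0⟩
end
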